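/- arXiv:2503.04575 — 7 statements merged into one kernel-verified Lean document; each statement's English description precedes it below -/
import Mathlib

section
/- For every T > 0, every real α > -1/2, and every i ∈ ℕ, the expansion coefficient of the power function t ↦ t^α relative to the i-th Legendre polynomial satisfies F_i^α = ∫₀^T t^α P̂(i,t) dt = T^α · √T · √(2i+1) · α^{\underline{i}} / (α+1)^{\overline{i+1}}, where α^{\underline{i}} = α(α-1)⋯(α-i+1) is the falling factorial and (α+1)^{\overline{i+1}} = (α+1)(α+2)⋯(α+i+1) is the rising factorial. -/
open MeasureTheory Finset

/-- Coefficients of the shifted Legendre polynomials: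
`l_{ik} = (-1)^(i-k) * C(i+k, i) * C(i, i-k)`. -/
noncomputable def legCoef (i k : ℕ) : ℝ :=
  (-1 : ℝ) ^ (i - k) * (Nat.choose (i + k) i : ℝ) * (Nat.choose i (i - k) : ℝ)

/-- Shifted Legendre polynomials on `[0, T]`, orthonormal in `L²([0,T])`:
`P̂(i,t) = √((2i+1)/T) · Σ_{k=0}^i l_{ik} (t/T)^k`. -/
noncomputable def legP (T : ℝ) (i : ℕ) (t : ℝ) : ℝ :=
  Real.sqrt ((2 * i + 1) / T) * ∑ k ∈ Finset.range (i + 1), legCoef i k * (t / T) ^ k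

/-- `F_i^α = ∫₀^T t^α P̂(i,t) dt`, the expansion coefficient of the power function
`t ↦ t^α` relative to the `i`-th Legendre polynomial. -/
noncomputable def Fcoef (T α : ℝ) (i : ℕ) : ℝ :=
  ∫ t in (0:ℝ)..T, t ^ α * legP T i t

/-- Falling factorial `x^{\underline{k}} = x(x-1)⋯(x-k+1)`. -/
noncomputable def fallFac (x : ℝ) (k : ℕ) : ℝ :=
  ∏ m ∈ Finset.range k, (x - m)

/-- Rising factorial `x^{\overline{k}} = x(x+1)⋯(x+k-1)`. -/
noncomputable def riseFac (x : ℝ) (k : ℕ) : ℝ :=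
  ∏ m ∈ Finset.range k, (x + m)

theorem prod_range_natCast_sub (k : ℕ) :
    ∏ j ∈ range k, ((k : ℝ) - j) = (k.factorial : ℝ) := by
  rw [← Nat.descFactorial_self, Nat.descFactorial_eq_prod_range, Nat.cast_prod]
  refine prod_congr rfl fun j hj => ?_
  rw [Nat.cast_sub (mem_range.mp hj).le]

theorem prod_range_erase_natCast_sub {n k : ℕ} (hkn : k ≤ n) :
    ∏ j ∈ (range (n + 1)).erase k, ((k : ℝ) - j) =
      (-1) ^ (n - k) * (k.factorial : ℝ) * ((n - k).factorial : ℝ) := by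
  induction n, hkn using Nat.le_induction with
  | base => simp [range_add_one, prod_range_natCast_sub]
  | succ n hkn ih =>
    rw [range_add_one, erase_insert_of_ne (by omega), prod_insert (by simp), ih,
      Nat.succ_sub hkn, Nat.factorial_succ, pow_succ]
    push_cast [Nat.cast_sub hkn]
    ring

theorem legCoef_eq {i k : ℕ} (hk : k ≤ i) :
    legCoef i k = Lagrange.nodalWeight (range (i + 1)) (fun j : ℕ => (j : ℝ)) k *
      ∏ m ∈ range i, ((k : ℝ) + 1 + m) := by
  have hasc : ∏ m ∈ range i, ((k : ℝ) + 1 + m) = (i.factorial : ℝ) * ((i + k).choose i : ℝ) := by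
    rw [add_comm i k]
    exact_mod_cast (Nat.ascFactorial_eq_prod_range (k + 1) i).symm.trans
      (Nat.ascFactorial_eq_factorial_mul_choose k i)
  have hchoose : (i.choose k : ℝ) * k.factorial * (i - k).factorial = i.factorial := by
    exact_mod_cast Nat.choose_mul_factorial_mul_factorial hk
  have hsign : ((-1 : ℝ) ^ (i - k)) * (-1) ^ (i - k) = 1 := by
    rw [← mul_pow]; simp
  rw [Lagrange.nodalWeight, prod_inv_distrib, prod_range_erase_natCast_sub hk, hasc, legCoef,
    Nat.choose_symm hk, ← hchoose]
  field_simp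
  linear_combination ((i + k).choose i : ℝ) * (i.choose k : ℝ) * hsign

/-- Partial fraction expansion of `α^{\underline{i}} / (α+1)^{\overline{i+1}}`. -/
theorem sum_legCoef_div {α : ℝ} (hα : -1 < α) (i : ℕ) :
    ∑ k ∈ range (i + 1), legCoef i k / (α + k + 1) =
      fallFac α i / riseFac (α + 1) (i + 1) := by
  set v : ℕ → ℝ := fun j => j
  have hv : Set.InjOn v (range (i + 1)) := Nat.cast_injective.injOn
  have hpos (k : ℕ) : 0 < α + 1 + k := by
    have : (0 : ℝ) ≤ k := k.cast_nonneg
    linarith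
  have hx : ∀ k ∈ range (i + 1), -(α + 1) ≠ v k := fun k _ h => by
    have := hpos k
    simp only [v] at h
    linarith
  have hinterp := Lagrange.eq_interpolate_of_eval_eq
    (f := Lagrange.nodal (range i) fun m : ℕ => -((m : ℝ) + 1))
    (fun k : ℕ => ∏ m ∈ range i, ((k : ℝ) + 1 + m)) hv
    (by rw [Lagrange.degree_nodal]; simp only [card_range, Nat.cast_lt, Nat.lt_succ_self])
    (fun k _ => by
      rw [Lagrange.eval_nodal]
      exact prod_congr rfl fun m _ => by simp only [v]; ring)
  have heval := congrArg (Polynomial.eval (-(α + 1))) hinterp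
  have hfall : ∏ m ∈ range i, (-(α + 1) - -((m : ℝ) + 1)) = (-1) ^ i * fallFac α i := by
    rw [fallFac, ← card_range i, ← prod_const, card_range, ← prod_mul_distrib]
    exact prod_congr rfl fun m _ => by ring
  have hrise : ∏ m ∈ range (i + 1), (-(α + 1) - v m) =
      (-1) ^ (i + 1) * riseFac (α + 1) (i + 1) := by
    rw [riseFac, ← card_range (i + 1), ← prod_const, card_range, ← prod_mul_distrib]
    exact prod_congr rfl fun m _ => by simp only [v]; ring
  have hsum : ∑ k ∈ range (i + 1), Lagrange.nodalWeight (range (i + 1)) v k *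
        (-(α + 1) - v k)⁻¹ * ∏ m ∈ range i, ((k : ℝ) + 1 + m) =
      -∑ k ∈ range (i + 1), legCoef i k / (α + k + 1) := by
    rw [← sum_neg_distrib]
    refine sum_congr rfl fun k hk => ?_
    rw [legCoef_eq (Nat.lt_succ_iff.mp (mem_range.mp hk)),
      show -(α + 1) - v k = -(α + k + 1) by simp only [v]; ring, inv_neg]
    ring
  rw [Lagrange.eval_interpolate_not_at_node _ hx, Lagrange.eval_nodal, Lagrange.eval_nodal, hfall,
    hrise, hsum] at heval
  have hne : riseFac (α + 1) (i + 1) ≠ 0 := prod_ne_zero_iff.mpr fun k _ => (hpos k).ne'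
  rw [eq_div_iff hne]
  apply mul_left_cancel₀ (pow_ne_zero i (neg_ne_zero.mpr (one_ne_zero (α := ℝ))))
  rw [heval]
  ring

theorem rpow_mul_div_pow_eq {T t : ℝ} (ht : 0 < t) (α : ℝ) (k : ℕ) :
    t ^ α * (t / T) ^ k = (T ^ k)⁻¹ * t ^ (α + k) := by
  rw [Real.rpow_add ht, Real.rpow_natCast, div_pow]
  ring

theorem intervalIntegrable_rpow_mul_div_pow {T α : ℝ} (hα : -1 < α) (k : ℕ) :
    IntervalIntegrable (fun t : ℝ => t ^ α * (t / T) ^ k) volume 0 T :=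
  (intervalIntegral.intervalIntegrable_rpow' hα).mul_continuousOn (by fun_prop)

theorem integral_rpow_mul_div_pow {T α : ℝ} (hT : 0 < T) (hα : -1 < α) (k : ℕ) :
    ∫ t in (0 : ℝ)..T, t ^ α * (t / T) ^ k = T ^ α * T / (α + k + 1) := by
  have hk : (0 : ℝ) ≤ k := k.cast_nonneg
  have hcongr : ∫ t in (0 : ℝ)..T, t ^ α * (t / T) ^ k =
      ∫ t in (0 : ℝ)..T, (T ^ k)⁻¹ * t ^ (α + k) := by
    refine intervalIntegral.integral_congr_ae (ae_of_all _ fun t ht => ?_)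
    rw [Set.uIoc_of_le hT.le] at ht
    exact rpow_mul_div_pow_eq ht.1 α k
  rw [hcongr, intervalIntegral.integral_const_mul, integral_rpow (Or.inl (by linarith)),
    Real.zero_rpow (by linarith), Real.rpow_add_one hT.ne', Real.rpow_add hT, Real.rpow_natCast]
  have : α + k + 1 ≠ 0 := by linarith
  field_simp
  ring

/-- the explicit formula
`F_i^α = T^α √T √(2i+1) α^{\underline{i}} / (α+1)^{\overline{i+1}}`. -/
theorem Fcoef_explicit (T : ℝ) (hT : 0 < T) (α : ℝ) (hα : -1/2 < α) (i : ℕ) :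
    Fcoef T α i =
      T ^ α * Real.sqrt T * Real.sqrt (2 * i + 1) * fallFac α i / riseFac (α + 1) (i + 1) := by
  have hα' : -1 < α := by linarith
  have hfun (t : ℝ) : t ^ α * legP T i t = Real.sqrt ((2 * i + 1) / T) *
      ∑ k ∈ range (i + 1), legCoef i k * (t ^ α * (t / T) ^ k) := by
    rw [legP, mul_left_comm, mul_sum]
    congr 1
    exact sum_congr rfl fun k _ => by ring
  have hint : Fcoef T α i = Real.sqrt ((2 * i + 1) / T) *
      (T ^ α * T * (fallFac α i / riseFac (α + 1) (i + 1))) := by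
    simp_rw [Fcoef, hfun]
    rw [intervalIntegral.integral_const_mul,
      intervalIntegral.integral_finsetSum (fun (k : ℕ) _ =>
        (intervalIntegrable_rpow_mul_div_pow hα' k).const_mul (legCoef i k)),
      ← sum_legCoef_div hα', mul_sum _ _ (T ^ α * T)]
    refine congrArg _ (sum_congr rfl fun k _ => ?_)
    rw [intervalIntegral.integral_const_mul, integral_rpow_mul_div_pow hT hα']
    ring
  have hsqrt : T / Real.sqrt T = Real.sqrt T := Real.div_sqrt
  rw [hint, Real.sqrt_div (by positivity)]
  linear_combination Real.sqrt (2 * i + 1) * T ^ α * (fallFac α i / riseFac (α + 1) (i + 1)) * hsqrt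
end

section
/- For every T > 0, every real α > -1/2, and every i ∈ ℕ, the coefficients F_i^α satisfy the recurrence in the index i: F_{i+1}^α = √((2i+3)/(2i+1)) · (α - i)/(α + i + 2) · F_i^α. -/
open MeasureTheory Finset

open Nat in
theorem legCoef_add_left (k j : ℕ) :
    legCoef (k + j) k = (-1 : ℝ) ^ j * (2 * k + j)! / ((k ! : ℝ) ^ 2 * j !) := by
  have h₁ : k + j + k - (k + j) = k := by omega
  rw [legCoef, Nat.add_sub_cancel_left, Nat.cast_choose ℝ (Nat.le_add_right (k + j) k),
    Nat.cast_choose ℝ (Nat.le_add_left j k), h₁, Nat.add_sub_cancel,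
    show k + j + k = 2 * k + j by ring]
  have := Nat.factorial_ne_zero k
  have := Nat.factorial_ne_zero j
  have := Nat.factorial_ne_zero (k + j)
  field_simp

theorem legCoef_succ_left {i k : ℕ} (h : k ≤ i) :
    ((i : ℝ) + 1 - k) * legCoef (i + 1) k = -((i : ℝ) + k + 1) * legCoef i k := by
  obtain ⟨j, rfl⟩ := Nat.exists_eq_add_of_le h
  rw [add_assoc k j 1, legCoef_add_left, legCoef_add_left, ← add_assoc (2 * k) j 1,
    Nat.factorial_succ, Nat.factorial_succ]
  have := Nat.factorial_ne_zero k
  have := Nat.factorial_ne_zero j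
  push_cast
  field_simp
  ring

theorem legCoef_succ_right {i k : ℕ} (h : k < i) :
    ((k : ℝ) + 1) ^ 2 * legCoef i (k + 1) =
      -(((i : ℝ) + k + 1) * ((i : ℝ) - k)) * legCoef i k := by
  obtain ⟨j, rfl⟩ := Nat.exists_eq_add_of_lt h
  rw [show legCoef (k + j + 1) (k + 1) = legCoef (k + 1 + j) (k + 1) by
      rw [add_right_comm], legCoef_add_left, add_assoc k j 1, legCoef_add_left,
    show 2 * (k + 1) + j = 2 * k + (j + 1) + 1 by ring, Nat.factorial_succ (2 * k + (j + 1)),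
    Nat.factorial_succ k, Nat.factorial_succ j]
  have := Nat.factorial_ne_zero k
  have := Nat.factorial_ne_zero j
  push_cast
  field_simp
  ring

theorem legCoef_succ_self (i : ℕ) :
    ((i : ℝ) + 1) * legCoef (i + 1) (i + 1) = 2 * (2 * i + 1) * legCoef i i := by
  have h₁ := legCoef_add_left (i + 1) 0
  have h₀ := legCoef_add_left i 0
  rw [add_zero] at h₁ h₀
  rw [h₁, h₀, show 2 * (i + 1) + 0 = 2 * i + 0 + 1 + 1 by ring, Nat.factorial_succ (2 * i + 0 + 1),
    Nat.factorial_succ (2 * i + 0), Nat.factorial_succ i]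
  have := Nat.factorial_ne_zero i
  push_cast
  field_simp
  ring

theorem sum_range_legCoef_succ_sub {i n : ℕ} (h : n ≤ i) :
    ((i : ℝ) + 1) * ∑ k ∈ range (n + 1), (legCoef (i + 1) k - legCoef i k) =
      -2 * ((i : ℝ) + n + 1) * legCoef i n := by
  induction n with
  | zero =>
    have := legCoef_succ_left h
    simp only [zero_add, sum_range_one]
    push_cast at this ⊢
    linear_combination this
  | succ n ih =>
    rw [sum_range_succ, mul_add, ih (by omega)]
    have hA := legCoef_succ_left h
    have hB := legCoef_succ_right (Nat.lt_of_succ_le h)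
    have hi : (n : ℝ) + 1 ≤ i := by exact_mod_cast h
    have hne : (i : ℝ) - n ≠ 0 := by linarith
    push_cast at hA ⊢
    apply mul_left_cancel₀ hne
    linear_combination (i + 1 : ℝ) * hA - 2 * hB

theorem sum_legCoef_succ (i : ℕ) :
    ∑ k ∈ range (i + 2), legCoef (i + 1) k = ∑ k ∈ range (i + 1), legCoef i k := by
  have h := sum_range_legCoef_succ_sub (le_refl i)
  have hs := legCoef_succ_self i
  rw [sum_sub_distrib] at h
  rw [sum_range_succ]
  have hne : (i : ℝ) + 1 ≠ 0 := by positivity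
  apply mul_left_cancel₀ hne
  linear_combination h + hs

theorem sum_legCoef_div_succ {x : ℝ} (hx : -1 < x) (i : ℕ) :
    (x + i + 2) * ∑ k ∈ range (i + 2), legCoef (i + 1) k / (x + k + 1) =
      (x - i) * ∑ k ∈ range (i + 1), legCoef i k / (x + k + 1) := by
  have hpos (k : ℕ) : x + k + 1 ≠ 0 := by
    have : (0 : ℝ) ≤ k := k.cast_nonneg
    linarith
  have hterm : ∀ k ∈ range (i + 1),
      (x + i + 2) * (legCoef (i + 1) k / (x + k + 1)) - (x - i) * (legCoef i k / (x + k + 1)) =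
        legCoef (i + 1) k - legCoef i k := fun k hk => by
    have := hpos k
    field_simp
    linear_combination legCoef_succ_left (Nat.lt_succ_iff.mp (mem_range.mp hk))
  have hsum := sum_congr rfl hterm
  have hone := sum_legCoef_succ i
  have hlast : (x + i + 2) * (legCoef (i + 1) (i + 1) / (x + (i + 1 : ℕ) + 1)) =
      legCoef (i + 1) (i + 1) := by
    have := hpos (i + 1)
    rw [show x + i + 2 = x + (i + 1 : ℕ) + 1 by push_cast; ring]
    field_simp
  rw [sum_sub_distrib, sum_sub_distrib, ← mul_sum, ← mul_sum] at hsum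
  rw [sum_range_succ] at hone
  rw [sum_range_succ, mul_add, hlast]
  linear_combination hsum + hone

theorem Fcoef_eq_sum {T α : ℝ} (hT : 0 < T) (hα : -1 < α) (i : ℕ) :
    Fcoef T α i = Real.sqrt ((2 * i + 1) / T) *
      (T ^ (α + 1) * ∑ k ∈ range (i + 1), legCoef i k / (α + k + 1)) := by
  have hexp (k : ℕ) : -1 < α + k := by
    have : (0 : ℝ) ≤ k := k.cast_nonneg
    linarith
  have hcongr : Fcoef T α i = ∫ t in (0 : ℝ)..T, Real.sqrt ((2 * i + 1) / T) *
      ∑ k ∈ range (i + 1), legCoef i k / T ^ k * t ^ (α + k) := by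
    refine intervalIntegral.integral_congr_ae (Filter.Eventually.of_forall fun t ht => ?_)
    rw [Set.uIoc_of_le hT.le] at ht
    rw [legP, mul_left_comm, mul_sum]
    congr 1
    refine sum_congr rfl fun k _ => ?_
    rw [Real.rpow_add_natCast ht.1.ne', div_pow]
    ring
  rw [hcongr, intervalIntegral.integral_const_mul, intervalIntegral.integral_finsetSum fun k _ =>
    (intervalIntegral.intervalIntegrable_rpow' (hexp k)).const_mul _]
  congr 1
  rw [mul_sum]
  refine sum_congr rfl fun k _ => ?_
  have := hexp k
  rw [intervalIntegral.integral_const_mul, integral_rpow (Or.inl this),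
    Real.zero_rpow (by linarith), add_right_comm α, Real.rpow_add_natCast hT.ne']
  field_simp
  ring

/-- recurrence in the index `i`:
`F_{i+1}^α = √((2i+3)/(2i+1)) · (α-i)/(α+i+2) · F_i^α`. -/
theorem Fcoef_rec_index (T : ℝ) (hT : 0 < T) (α : ℝ) (hα : -1/2 < α) (i : ℕ) :
    Fcoef T α (i + 1) =
      Real.sqrt ((2 * i + 3) / (2 * i + 1)) * ((α - i) / (α + i + 2)) * Fcoef T α i := by
  have hα' : -1 < α := by linarith
  have hden : α + i + 2 ≠ 0 := by
    have : (0 : ℝ) ≤ i := i.cast_nonneg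
    linarith
  have hsqrt : Real.sqrt ((2 * (i + 1 : ℕ) + 1) / T) =
      Real.sqrt ((2 * i + 3) / (2 * i + 1)) * Real.sqrt ((2 * i + 1) / T) := by
    rw [← Real.sqrt_mul (by positivity)]
    congr 1
    push_cast
    field_simp
    ring
  have hsum : ∑ k ∈ range (i + 2), legCoef (i + 1) k / (α + k + 1) =
      (α - i) / (α + i + 2) * ∑ k ∈ range (i + 1), legCoef i k / (α + k + 1) := by
    rw [div_mul_eq_mul_div, eq_div_iff hden, mul_comm, sum_legCoef_div_succ hα']
  rw [Fcoef_eq_sum hT hα', Fcoef_eq_sum hT hα', hsqrt, hsum]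
  ring
end

section
/- For every T > 0 and every real α > -1/2 that is not an integer, the Raabe–Duhamel limit for the squared expansion coefficients of the power function t ↦ t^α holds: lim_{i→∞} i · ( (F_i^α)² / (F_{i+1}^α)² − 1 ) = 4α + 3. (For non-integer α all coefficients F_i^α are nonzero, so the ratio is well defined.) -/
open MeasureTheory Finset

/-- The factors of the Lagrange nodal weight at the node `k` among `0, …, k + d`. -/
lemma prod_erase_range_sub_eq (k d : ℕ) :
    ∏ j ∈ (Finset.range (k + d + 1)).erase k, ((j : ℝ) - k) =
      (-1) ^ k * (k.factorial : ℝ) * (d.factorial : ℝ) := by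
  induction d with
  | zero =>
    have h : (Finset.range (k + 0 + 1)).erase k = Finset.range k := by
      ext j
      simp only [Finset.mem_erase, Finset.mem_range]
      omega
    rw [h]
    have h2 : ∀ j ∈ Finset.range k, ((j : ℝ) - k) = (-1) * (((k - 1 - j : ℕ) : ℝ) + 1) := by
      intro j hj
      rw [Finset.mem_range] at hj
      have : ((k - 1 - j : ℕ) : ℝ) + 1 + j = k := by
        exact_mod_cast (by omega : (k - 1 - j) + 1 + j = k)
      linarith
    rw [Finset.prod_congr rfl h2, Finset.prod_mul_distrib,
      Finset.prod_range_reflect (fun j : ℕ => (j : ℝ) + 1) k, ← Finset.prod_range_add_one_eq_factorial]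
    push_cast
    simp
  | succ d ih =>
    have h : (Finset.range (k + (d + 1) + 1)).erase k =
        insert (k + d + 1) ((Finset.range (k + d + 1)).erase k) := by
      ext j
      simp only [Finset.mem_erase, Finset.mem_range, Finset.mem_insert]
      omega
    rw [h, Finset.prod_insert (by simp), ih, Nat.factorial_succ]
    push_cast
    ring

lemma prod_range_neg_sub_eq (k i : ℕ) :
    (∏ m ∈ Finset.range i, (-(k : ℝ) - 1 - m)) * (k.factorial : ℝ) =
      (-1) ^ i * ((i + k).factorial : ℝ) := by
  induction i with
  | zero => simp
  | succ i ih =>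
    rw [Finset.prod_range_succ, mul_right_comm, ih, Nat.add_right_comm, Nat.factorial_succ]
    push_cast
    ring

lemma legCoef_eq_s4 (k d : ℕ) :
    legCoef (k + d) k = (∏ j ∈ (Finset.range (k + d + 1)).erase k, ((j : ℝ) - k))⁻¹ *
      ∏ m ∈ Finset.range (k + d), (-(k : ℝ) - 1 - m) := by
  have hk : (k.factorial : ℝ) ≠ 0 := by positivity
  have hd : (d.factorial : ℝ) ≠ 0 := by positivity
  rw [prod_erase_range_sub_eq, eq_div_of_mul_eq hk (prod_range_neg_sub_eq k (k + d))]
  unfold legCoef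
  rw [Nat.add_sub_cancel_left, Nat.cast_add_choose, ← Nat.choose_symm_add, Nat.cast_add_choose]
  field_simp
  rw [pow_add, mul_comm]

/-- Partial fraction decomposition of `∏_{m<i} (x-1-m) / ∏_{m≤i} (x+m)`. -/
lemma sum_legCoef_div_s4 (i : ℕ) (x : ℝ) (hx : ∀ k : ℕ, x + k ≠ 0) :
    ∑ k ∈ Finset.range (i + 1), legCoef i k / (x + k) =
      (∏ m ∈ Finset.range i, (x - 1 - m)) / ∏ m ∈ Finset.range (i + 1), (x + m) := by
  set Q : Polynomial ℝ := ∏ m ∈ Finset.range i, (Polynomial.X - Polynomial.C (1 + (m : ℝ)))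
    with hQ
  set v : ℕ → ℝ := fun k => -(k : ℝ) with hv
  have hinj : Set.InjOn v (Finset.range (i + 1)) := by
    intro a _ b _ h
    simpa [hv] using h
  have heval (y : ℝ) : Q.eval y = ∏ m ∈ Finset.range i, (y - 1 - m) := by
    simp [hQ, Polynomial.eval_prod, sub_sub]
  have hdeg : Q.degree < (Finset.range (i + 1)).card := by
    rw [hQ, Polynomial.degree_prod]
    simp only [Polynomial.degree_X_sub_C, Finset.sum_const, Finset.card_range, nsmul_eq_mul,
      mul_one]
    exact_mod_cast Nat.lt_succ_self i
  have hnodes : ∀ k ∈ Finset.range (i + 1), x ≠ v k := by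
    intro k _ h
    exact hx k (by rw [h]; simp [hv])
  have hprod : ∏ m ∈ Finset.range (i + 1), (x + m) ≠ 0 :=
    Finset.prod_ne_zero_iff.2 fun m _ => hx m
  have key := Lagrange.eval_interpolate_not_at_node (r := fun k => Q.eval (v k)) hnodes
  rw [← Lagrange.eq_interpolate hinj hdeg, heval, Lagrange.eval_nodal] at key
  rw [eq_div_iff hprod, key, mul_comm]
  simp only [hv, sub_neg_eq_add]
  congr 1
  refine Finset.sum_congr rfl fun k hk => ?_
  obtain ⟨d, rfl⟩ := Nat.exists_eq_add_of_le (Nat.lt_succ_iff.1 (Finset.mem_range.1 hk))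
  rw [legCoef_eq_s4, heval, Lagrange.nodalWeight, Finset.prod_inv_distrib]
  simp only [neg_sub_neg]
  ring

lemma intervalIntegral_rpow_mul_div_pow {T α : ℝ} (hT : 0 < T) (k : ℕ) (hα : -1 < α)
    (hαk : α + k ≠ 0) :
    IntervalIntegrable (fun t => t ^ α * (t / T) ^ k) volume 0 T ∧
      ∫ t in (0 : ℝ)..T, t ^ α * (t / T) ^ k = T ^ (α + 1) / (α + 1 + k) := by
  have hk : (0 : ℝ) ≤ k := k.cast_nonneg
  have hcongr : Set.EqOn (fun t : ℝ => t ^ (α + k) / T ^ k) (fun t => t ^ α * (t / T) ^ k)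
      (Set.uIcc 0 T) := by
    intro t ht
    rw [Set.uIcc_of_le hT.le] at ht
    simp only
    rw [Real.rpow_add_natCast' ht.1 hαk, div_pow, mul_div_assoc]
  refine ⟨((intervalIntegral.intervalIntegrable_rpow' (by linarith)).div_const _).congr
    (hcongr.mono Set.uIoc_subset_uIcc), ?_⟩
  rw [← intervalIntegral.integral_congr hcongr, intervalIntegral.integral_div,
    integral_rpow (Or.inl (by linarith)), Real.zero_rpow (by linarith), add_right_comm,
    Real.rpow_add_natCast hT.ne']
  have : T ^ k ≠ 0 := by positivity
  have : α + 1 + k ≠ 0 := by linarith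
  field_simp
  ring

lemma Fcoef_eq {T α : ℝ} (hT : 0 < T) (hα : -1 < α) (hαnat : ∀ k : ℕ, α + k ≠ 0) (i : ℕ) :
    Fcoef T α i = Real.sqrt ((2 * i + 1) / T) * T ^ (α + 1) *
      ((∏ m ∈ Finset.range i, (α - m)) / ∏ m ∈ Finset.range (i + 1), (α + 1 + m)) := by
  have hint (k : ℕ) := intervalIntegral_rpow_mul_div_pow hT k hα (hαnat k)
  have hsum := sum_legCoef_div_s4 i (α + 1) fun k => by
    have : (0 : ℝ) ≤ k := k.cast_nonneg
    linarith
  simp only [add_sub_cancel_right] at hsum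
  rw [← hsum]
  have hexpand (t : ℝ) : t ^ α * legP T i t = Real.sqrt ((2 * i + 1) / T) *
      ∑ k ∈ Finset.range (i + 1), legCoef i k * (t ^ α * (t / T) ^ k) := by
    rw [legP, mul_left_comm, Finset.mul_sum]
    simp only [mul_left_comm]
  simp only [Fcoef, hexpand]
  rw [intervalIntegral.integral_const_mul,
    intervalIntegral.integral_finsetSum fun k _ => (hint k).1.const_mul (legCoef i k),
    mul_assoc]
  congr 1
  rw [Finset.mul_sum]
  refine Finset.sum_congr rfl fun k _ => ?_
  rw [intervalIntegral.integral_const_mul, (hint k).2]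
  ring

lemma Fcoef_sq_div_succ_sq {T α : ℝ} (hT : 0 < T) (hα : -1 < α) (hαnotint : ∀ n : ℤ, α ≠ n)
    (i : ℕ) :
    Fcoef T α i ^ 2 / Fcoef T α (i + 1) ^ 2 =
      (2 * i + 1) / (2 * i + 3) * ((i + 2 + α) / (i - α)) ^ 2 := by
  have hnat (k : ℕ) : α + k ≠ 0 := fun h => hαnotint (-k) (by push_cast; linarith)
  have hsub (k : ℕ) : α - k ≠ 0 := fun h => hαnotint k (by push_cast; linarith)
  have hnum : ∏ m ∈ Finset.range i, (α - m) ≠ 0 := Finset.prod_ne_zero_iff.2 fun m _ => hsub m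
  have hpos (k : ℕ) : α + 1 + k ≠ 0 := by
    have : (0 : ℝ) ≤ k := k.cast_nonneg
    linarith
  have hden : ∏ m ∈ Finset.range (i + 1), (α + 1 + m) ≠ 0 :=
    Finset.prod_ne_zero_iff.2 fun m _ => hpos m
  have hTp : T ^ (α + 1) ≠ 0 := (Real.rpow_pos_of_pos hT _).ne'
  have h1 : α + 1 + (i + 1 : ℝ) ≠ 0 := by exact_mod_cast hpos (i + 1)
  rw [Fcoef_eq hT hα hnat, Fcoef_eq hT hα hnat, Finset.prod_range_succ (fun m : ℕ => α - m) i,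
    Finset.prod_range_succ (fun m : ℕ => α + 1 + m) (i + 1)]
  simp only [mul_pow]
  rw [Real.sq_sqrt (by positivity), Real.sq_sqrt (by positivity)]
  push_cast
  rw [show (2 * ((i : ℝ) + 1) + 1) = 2 * i + 3 by ring,
    show (i : ℝ) + 2 + α = α + 1 + (i + 1) by ring, ← neg_sub α i, div_neg, neg_sq]
  have h2 := hsub i
  field_simp

lemma tendsto_nat_mul_ratio_sub_one (α : ℝ) :
    Filter.Tendsto
      (fun i : ℕ => (i : ℝ) * ((2 * i + 1) / (2 * i + 3) * ((i + 2 + α) / (i - α)) ^ 2 - 1))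
      Filter.atTop (nhds (4 * α + 3)) := by
  let g : ℝ → ℝ := fun u =>
    (8 * α + 6 + (2 * (2 + α) ^ 2 + 2 * (2 + α) - 2 * α ^ 2 + 6 * α) * u +
      ((2 + α) ^ 2 - 3 * α ^ 2) * u ^ 2) / ((2 + 3 * u) * (1 - α * u) ^ 2)
  have hg : ContinuousAt g 0 :=
    ContinuousAt.div (by fun_prop) (by fun_prop) (by norm_num)
  have hg0 : g 0 = 4 * α + 3 := by
    simp only [g]
    ring
  rw [← hg0]
  refine (hg.tendsto.comp (tendsto_inv_atTop_nhds_zero_nat (𝕜 := ℝ))).congr' ?_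
  filter_upwards [Filter.eventually_gt_atTop 0, Filter.eventually_gt_atTop ⌈α⌉₊] with i hi hiα
  have hi' : (i : ℝ) ≠ 0 := by positivity
  have h1 : (i : ℝ) - α ≠ 0 := (sub_pos.2 (Nat.lt_of_ceil_lt hiα)).ne'
  have h2 : 2 * (i : ℝ) + 3 ≠ 0 := by positivity
  have h3 : 2 + 3 * (i : ℝ)⁻¹ = (2 * i + 3) / i := by field_simp
  have h4 : 1 - α * (i : ℝ)⁻¹ = (i - α) / i := by field_simp
  simp only [g, Function.comp_apply, h3, h4]
  field_simp
  ring

/-- Raabe–Duhamel limit for the squared coefficients: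
`lim_{i→∞} i·((F_i^α)²/(F_{i+1}^α)² − 1) = 4α + 3` for non-integer `α > -1/2`. -/
theorem Fcoef_raabe_duhamel (T : ℝ) (hT : 0 < T) (α : ℝ) (hα : -1/2 < α)
    (hαnotint : ∀ n : ℤ, α ≠ n) :
    Filter.Tendsto
      (fun i : ℕ => (i : ℝ) * ((Fcoef T α i) ^ 2 / (Fcoef T α (i + 1)) ^ 2 - 1))
      Filter.atTop (nhds (4 * α + 3)) := by
  simp only [Fcoef_sq_div_succ_sq hT (by linarith : -1 < α) hαnotint]
  exact tendsto_nat_mul_ratio_sub_one α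
end

section
/- For every T > 0, every H ∈ (0,1), and all i, j ∈ ℕ, the expansion coefficients of the fractional Brownian motion kernel relative to the Legendre polynomials satisfy K_{ij}^H = a_H · Γ(3/2 - H) · √((2j+1)/T) · Σ_{k=0}^j [ l_{jk} · (3/2 - H)^{\overline{k}} / ( T^k · (H + 1/2 + k) · k! ) ] · F_i^{H+1/2+k}, where (3/2-H)^{\overline{k}} = (3/2-H)(5/2-H)⋯(3/2-H+k-1) is the rising factorial. -/
open MeasureTheory Finset

/-- Left-sided Riemann–Liouville fractional integral of order `β`:
`(J^β φ)(t) = (1/Γ(β)) ∫₀^t φ(τ)(t-τ)^{β-1} dτ`. -/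
noncomputable def rlInt (β : ℝ) (φ : ℝ → ℝ) (t : ℝ) : ℝ :=
  (1 / Real.Gamma β) * ∫ τ in (0:ℝ)..t, φ τ * (t - τ) ^ (β - 1)

/-- `a_H = √(2H·Γ(H+1/2)·Γ(3/2-H)/Γ(2-2H))`. -/
noncomputable def aH (H : ℝ) : ℝ :=
  Real.sqrt (2 * H * Real.Gamma (H + 1/2) * Real.Gamma (3/2 - H) / Real.Gamma (2 - 2 * H))

open scoped Classical in
/-- The operator `𝒦_H` corresponding to the kernel of the integral representation of the
fractional Brownian motion with Hurst index `H`. -/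
noncomputable def Kop (H : ℝ) (φ : ℝ → ℝ) (t : ℝ) : ℝ :=
  if H < 1/2 then
    aH H * rlInt (2 * H)
      (fun s => s ^ ((1:ℝ)/2 - H) * rlInt ((1:ℝ)/2 - H) (fun τ => τ ^ (H - 1/2) * φ τ) s) t
  else if 1/2 < H then
    aH H * rlInt 1
      (fun s => s ^ (H - (1:ℝ)/2) * rlInt (H - (1:ℝ)/2) (fun τ => τ ^ ((1:ℝ)/2 - H) * φ τ) s) t
  else ∫ τ in (0:ℝ)..t, φ τ

/-- `K_{ij}^H = ∫₀^T P̂(i,t) (𝒦_H P̂(j,·))(t) dt`, the expansion coefficients of the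
fractional Brownian motion kernel relative to the Legendre polynomials on `[0,T]`. -/
noncomputable def Kcoef (T H : ℝ) (i j : ℕ) : ℝ :=
  ∫ t in (0:ℝ)..T, legP T i t * Kop H (legP T j) t

/-- The Beta integral on `[0, t]` over the reals. -/
theorem integral_rpow_mul_sub_rpow {p β t : ℝ} (hp : -1 < p) (hβ : 0 < β) (ht : 0 < t) :
    ∫ x in (0:ℝ)..t, x ^ p * (t - x) ^ (β - 1) =
      t ^ (p + β) * (Real.Gamma (p + 1) * Real.Gamma β / Real.Gamma (p + 1 + β)) := by
  have h := Complex.betaIntegral_scaled ((p + 1 : ℝ) : ℂ) (β : ℂ) ht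
  rw [Complex.betaIntegral_eq_Gamma_mul_div _ _ (by simp; linarith) (by simpa using hβ)] at h
  rw [← Complex.ofReal_inj, ← intervalIntegral.integral_ofReal]
  have e : (t : ℂ) ^ (((p + 1 : ℝ) : ℂ) + (β : ℂ) - 1) = ((t ^ (p + β) : ℝ) : ℂ) := by
    rw [Complex.ofReal_cpow ht.le]
    congr 1
    push_cast
    ring
  rw [e, ← Complex.ofReal_add, Complex.Gamma_ofReal, Complex.Gamma_ofReal,
    Complex.Gamma_ofReal] at h
  push_cast at h ⊢
  rw [← h]
  refine intervalIntegral.integral_congr fun x hx => ?_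
  rw [Set.uIcc_of_le ht.le] at hx
  rw [Complex.ofReal_cpow hx.1, Complex.ofReal_cpow (sub_nonneg.2 hx.2)]
  push_cast
  simp

theorem intervalIntegrable_rpow_mul_sub_rpow {p β t : ℝ} (hp : -1 < p) (hβ : 0 < β)
    (ht : 0 < t) :
    IntervalIntegrable (fun x : ℝ => x ^ p * (t - x) ^ (β - 1)) volume 0 t := by
  apply intervalIntegral.intervalIntegrable_of_integral_ne_zero
  rw [integral_rpow_mul_sub_rpow hp hβ ht]
  have h₁ := Real.Gamma_pos_of_pos (show 0 < p + 1 by linarith)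
  have h₂ := Real.Gamma_pos_of_pos hβ
  have h₃ := Real.Gamma_pos_of_pos (show 0 < p + 1 + β by linarith)
  positivity

theorem rlInt_congr {β t : ℝ} {φ ψ : ℝ → ℝ} (ht : 0 < t) (h : ∀ τ, 0 < τ → φ τ = ψ τ) :
    rlInt β φ t = rlInt β ψ t := by
  unfold rlInt
  rw [intervalIntegral.integral_of_le ht.le, intervalIntegral.integral_of_le ht.le]
  congr 1
  exact setIntegral_congr_fun measurableSet_Ioc fun x hx => by simp only [h x hx.1]

/-- Fractional integral of a finite combination of the powers `τ ^ (p + k)`. -/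
theorem rlInt_sum_rpow {p β t : ℝ} (hp : -1 < p) (hβ : 0 < β) (ht : 0 < t)
    (s : Finset ℕ) (c : ℕ → ℝ) :
    rlInt β (fun τ => ∑ k ∈ s, c k * τ ^ (p + k)) t =
      ∑ k ∈ s, c k * (Real.Gamma (p + k + 1) / Real.Gamma (p + k + 1 + β)) *
        t ^ (p + k + β) := by
  have hk (k : ℕ) : -1 < p + k := by have : (0:ℝ) ≤ k := k.cast_nonneg; linarith
  have hΓ := (Real.Gamma_pos_of_pos hβ).ne'
  unfold rlInt
  simp_rw [Finset.sum_mul, mul_assoc]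
  rw [intervalIntegral.integral_finsetSum fun k _ =>
    (intervalIntegrable_rpow_mul_sub_rpow (hk k) hβ ht).const_mul (c k), Finset.mul_sum]
  refine Finset.sum_congr rfl fun k _ => ?_
  rw [intervalIntegral.integral_const_mul, integral_rpow_mul_sub_rpow (hk k) hβ ht]
  field_simp

theorem Gamma_add_nat_eq_mul_riseFac {x : ℝ} (hx : 0 < x) (k : ℕ) :
    Real.Gamma (x + k) = Real.Gamma x * riseFac x k := by
  induction k with
  | zero => simp [riseFac]
  | succ k ih =>
    have hk : x + k ≠ 0 := by positivity
    rw [riseFac, Finset.prod_range_succ, ← riseFac, Nat.cast_succ, ← add_assoc,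
      Real.Gamma_add_one hk, ih]
    ring

theorem rpow_mul_legP {T t : ℝ} (ht : 0 < t) (p : ℝ) (j : ℕ) :
    t ^ p * legP T j t =
      ∑ k ∈ Finset.range (j + 1),
        Real.sqrt ((2 * j + 1) / T) * legCoef j k / T ^ k * t ^ (p + k) := by
  rw [legP, Finset.mul_sum, Finset.mul_sum]
  refine Finset.sum_congr rfl fun k _ => ?_
  rw [Real.rpow_add ht, Real.rpow_natCast, div_pow]
  ring

theorem rlInt_rpow_mul_legP {T p β s : ℝ} (hp : -1 < p) (hβ : 0 < β) (hs : 0 < s) (j : ℕ) :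
    rlInt β (fun τ => τ ^ p * legP T j τ) s =
      ∑ k ∈ Finset.range (j + 1), Real.sqrt ((2 * j + 1) / T) * legCoef j k / T ^ k *
        (Real.Gamma (p + k + 1) / Real.Gamma (p + k + 1 + β)) * s ^ (p + k + β) := by
  rw [rlInt_congr hs fun τ hτ => rpow_mul_legP hτ p j, rlInt_sum_rpow hp hβ hs]

/-- Composition of two weighted fractional integrals, applied to a Legendre polynomial. -/
theorem rlInt_rpow_mul_rlInt_rpow_mul_legP {T p β q γ t : ℝ} (hp : -1 < p) (hβ : 0 < β)
    (hq : -1 < q + p + β) (hγ : 0 < γ) (ht : 0 < t) (j : ℕ) :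
    rlInt γ (fun s => s ^ q * rlInt β (fun τ => τ ^ p * legP T j τ) s) t =
      ∑ k ∈ Finset.range (j + 1), Real.sqrt ((2 * j + 1) / T) * legCoef j k / T ^ k *
        (Real.Gamma (p + k + 1) / Real.Gamma (p + k + 1 + β)) *
        (Real.Gamma (q + p + β + k + 1) / Real.Gamma (q + p + β + k + 1 + γ)) *
        t ^ (q + p + β + k + γ) := by
  rw [← rlInt_sum_rpow hq hγ ht]
  refine rlInt_congr ht fun s hs => ?_
  rw [rlInt_rpow_mul_legP hp hβ hs, Finset.mul_sum]
  refine Finset.sum_congr rfl fun k _ => ?_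
  rw [show q + p + β + k = q + (p + k + β) by ring, Real.rpow_add hs q]
  ring

theorem aH_one_half : aH (1 / 2) = 1 := by
  have h₁ : (1 / 2 + 1 / 2 : ℝ) = 1 := by norm_num
  have h₂ : (3 / 2 - 1 / 2 : ℝ) = 1 := by norm_num
  have h₃ : (2 - 2 * (1 / 2) : ℝ) = 1 := by norm_num
  rw [aH, h₁, h₂, h₃]
  simp

theorem Kop_legP {T H t : ℝ} (hH : H ∈ Set.Ioo (0:ℝ) 1) (ht : 0 < t) (j : ℕ) :
    Kop H (legP T j) t =
      aH H * Real.Gamma (3/2 - H) * Real.sqrt ((2 * j + 1) / T) *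
        ∑ k ∈ Finset.range (j + 1),
          legCoef j k * riseFac (3/2 - H) k / (T ^ k * (H + 1/2 + k) * (Nat.factorial k : ℝ)) *
            t ^ (H + 1/2 + k) := by
  obtain ⟨h0, h1⟩ := hH
  have hpos (k : ℕ) : 0 < H + 1 / 2 + k := by positivity
  have hfac (k : ℕ) : (Nat.factorial k : ℝ) ≠ 0 := by positivity
  have hrise (k : ℕ) := Gamma_add_nat_eq_mul_riseFac (show 0 < 3 / 2 - H by linarith) k
  rw [Finset.mul_sum]
  rcases lt_trichotomy H (1 / 2) with h | h | h
  · rw [Kop, if_pos h, rlInt_rpow_mul_rlInt_rpow_mul_legP (by linarith) (by linarith)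
      (by linarith) (by linarith) ht, Finset.mul_sum]
    refine Finset.sum_congr rfl fun k _ => ?_
    have hΓ := (Real.Gamma_pos_of_pos (hpos k)).ne'
    have hk := (hpos k).ne'
    rw [show H - 1 / 2 + k + 1 = H + 1 / 2 + k by ring,
      show H + 1 / 2 + k + (1 / 2 - H) = (k : ℝ) + 1 by ring, Real.Gamma_nat_eq_factorial,
      show 1 / 2 - H + (H - 1 / 2) + (1 / 2 - H) + (k : ℝ) + 1 = 3 / 2 - H + k by ring,
      show 3 / 2 - H + k + 2 * H = (H + 1 / 2 + k) + 1 by ring, Real.Gamma_add_one hk, hrise,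
      show 1 / 2 - H + (H - 1 / 2) + (1 / 2 - H) + (k : ℝ) + 2 * H = H + 1 / 2 + k by ring]
    have := hfac k
    generalize t ^ (H + 1 / 2 + (k : ℝ)) = u
    generalize H + 1 / 2 + (k : ℝ) = v at *
    field_simp
  · subst h
    rw [Kop, if_neg (lt_irrefl _), if_neg (lt_irrefl _), aH_one_half]
    have e : ∫ τ in (0:ℝ)..t, legP T j τ = rlInt 1 (fun τ => τ ^ (0:ℝ) * legP T j τ) t := by
      simp [rlInt]
    rw [e, rlInt_rpow_mul_legP (by norm_num) one_pos ht]
    refine Finset.sum_congr rfl fun k _ => ?_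
    have hk : (k : ℝ) + 1 ≠ 0 := by positivity
    have hr := hrise k
    rw [show (3 / 2 - 1 / 2 : ℝ) = 1 by norm_num, Real.Gamma_one, one_mul, add_comm,
      Real.Gamma_nat_eq_factorial] at hr
    rw [show (3 / 2 - 1 / 2 : ℝ) = 1 by norm_num, Real.Gamma_one, ← hr, zero_add,
      Real.Gamma_add_one hk, Real.Gamma_nat_eq_factorial,
      show 1 / 2 + 1 / 2 + (k : ℝ) = k + 1 by ring]
    have := hfac k
    field_simp
  · rw [Kop, if_neg h.not_gt, if_pos h, rlInt_rpow_mul_rlInt_rpow_mul_legP (by linarith)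
      (by linarith) (by linarith) one_pos ht, Finset.mul_sum]
    refine Finset.sum_congr rfl fun k _ => ?_
    have hΓ := (Real.Gamma_pos_of_pos (hpos k)).ne'
    have hk := (hpos k).ne'
    rw [show 1 / 2 - H + k + 1 = 3 / 2 - H + k by ring,
      show 3 / 2 - H + k + (H - 1 / 2) = (k : ℝ) + 1 by ring, Real.Gamma_nat_eq_factorial,
      show H - 1 / 2 + (1 / 2 - H) + (H - 1 / 2) + (k : ℝ) + 1 = H + 1 / 2 + k by ring,
      Real.Gamma_add_one hk, hrise]
    have := hfac k
    generalize t ^ (H + 1 / 2 + (k : ℝ)) = u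
    generalize H + 1 / 2 + (k : ℝ) = v at *
    field_simp

theorem continuous_legP (T : ℝ) (i : ℕ) : Continuous (legP T i) := by
  unfold legP
  fun_prop

/-- Theorem 1, column formula: for every `H ∈ (0,1)`,
`K_{ij}^H = a_H Γ(3/2-H) √((2j+1)/T) Σ_{k=0}^j l_{jk}(3/2-H)^{\overline{k}}
            / (T^k (H+1/2+k) k!) · F_i^{H+1/2+k}`. -/
theorem Kcoef_column_formula (T : ℝ) (hT : 0 < T) (H : ℝ) (hH : H ∈ Set.Ioo (0:ℝ) 1)
    (i j : ℕ) :
    Kcoef T H i j =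
      aH H * Real.Gamma (3/2 - H) * Real.sqrt ((2 * j + 1) / T) *
        ∑ k ∈ Finset.range (j + 1),
          legCoef j k * riseFac (3/2 - H) k / (T ^ k * (H + 1/2 + k) * (Nat.factorial k : ℝ)) *
            Fcoef T (H + 1/2 + k) i := by
  have hc (k : ℕ) : Continuous fun t : ℝ => t ^ (H + 1/2 + k) * legP T i t :=
    (Real.continuous_rpow_const (by have := hH.1; positivity)).mul (continuous_legP T i)
  simp_rw [Fcoef, ← intervalIntegral.integral_const_mul]
  rw [Kcoef, ← intervalIntegral.integral_finsetSum fun k _ =>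
    ((hc k).intervalIntegrable 0 T).const_mul _, ← intervalIntegral.integral_const_mul,
    intervalIntegral.integral_of_le hT.le, intervalIntegral.integral_of_le hT.le]
  refine setIntegral_congr_fun measurableSet_Ioc fun t ht => ?_
  rw [Kop_legP hH ht.1, mul_left_comm, Finset.mul_sum]
  congr 1
  exact Finset.sum_congr rfl fun k _ => by ring
end

section
/- For every T > 0 and all i, j ∈ ℕ, the matrix representation of the first-order integration operator relative to the Legendre polynomials is tridiagonal: ∫₀^T P̂(i,t) · ( ∫₀^t P̂(j,τ) dτ ) dt equals T/2 if i = j = 0; T/(2√(4i² - 1)) if i = j + 1; −T/(2√(4j² - 1)) if j = i + 1; and 0 in all other cases. -/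
open MeasureTheory Finset

open Polynomial in
/-- The shifted Legendre polynomial on `[0, 1]`, normalised to take the value `1` at `1`. -/
noncomputable def unitLegendre (n : ℕ) : ℝ[X] :=
  (-1 : ℝ) ^ n • (shiftedLegendre n).map (Int.castRingHom ℝ)

lemma coeff_unitLegendre (n k : ℕ) :
    (unitLegendre n).coeff k = (-1 : ℝ) ^ (n + k) * n.choose k * (n + k).choose n := by
  simp [unitLegendre, Polynomial.coeff_shiftedLegendre, pow_add, mul_assoc]

lemma legCoef_eq_coeff {n k : ℕ} (h : k ≤ n) : legCoef n k = (unitLegendre n).coeff k := by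
  obtain ⟨d, rfl⟩ := Nat.exists_eq_add_of_le h
  have hsign : (-1 : ℝ) ^ (k + d + k) = (-1) ^ d := by
    rw [show k + d + k = 2 * k + d by ring, pow_add, pow_mul]; simp
  rw [coeff_unitLegendre, legCoef, Nat.choose_symm h, hsign, Nat.add_sub_cancel_left]
  ring

lemma natDegree_unitLegendre_le (n : ℕ) : (unitLegendre n).natDegree ≤ n :=
  (Polynomial.natDegree_smul_le _ _).trans <|
    Polynomial.natDegree_map_le.trans (Polynomial.natDegree_shiftedLegendre n).le

lemma legP_eq_eval (T : ℝ) (n : ℕ) (t : ℝ) :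
    legP T n t = √((2 * n + 1) / T) * (unitLegendre n).eval (t / T) := by
  rw [legP, Polynomial.eval_eq_sum_range' (Nat.lt_succ_of_le (natDegree_unitLegendre_le n))]
  congr 1
  refine Finset.sum_congr rfl fun k hk => ?_
  rw [legCoef_eq_coeff (Nat.lt_succ_iff.mp (Finset.mem_range.mp hk))]

lemma coeff_zero_unitLegendre (n : ℕ) : (unitLegendre n).coeff 0 = (-1) ^ n := by
  simp [coeff_unitLegendre]

lemma coeff_succ_unitLegendre (n k : ℕ) :
    ((k : ℝ) + 1) ^ 2 * (unitLegendre n).coeff (k + 1) =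
      -((n - k) * (n + k + 1) * (unitLegendre n).coeff k) := by
  simp only [coeff_unitLegendre]
  have h₁ : (n.choose (k + 1) : ℝ) * (k + 1) = n.choose k * (n - k) := by
    rcases le_or_gt k n with h | h
    · rw [← Nat.cast_sub h]; exact_mod_cast Nat.choose_succ_right_eq n k
    · simp [Nat.choose_eq_zero_of_lt h, Nat.choose_eq_zero_of_lt (h.trans (Nat.lt_succ_self k))]
  have h₂ : ((n + (k + 1)).choose n : ℝ) * (k + 1) = (n + k + 1) * (n + k).choose n := by
    have h := Nat.choose_mul_succ_eq (n + k) n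
    rw [show n + k + 1 - n = k + 1 by omega] at h
    rw [← add_assoc, mul_comm _ ((n + k).choose n : ℝ)]
    exact_mod_cast h.symm
  rw [← add_assoc, pow_succ]
  linear_combination (-(-1) ^ (n + k) * ((n + (k + 1)).choose n : ℝ) * (k + 1)) * h₁
    - (-1) ^ (n + k) * (n.choose k : ℝ) * (n - k) * h₂

lemma coeff_unitLegendre_succ (n k : ℕ) :
    ((n : ℝ) + 1 - k) * (unitLegendre (n + 1)).coeff k =
      -((n + 1 + k) * (unitLegendre n).coeff k) := by
  simp only [coeff_unitLegendre]
  have h₁ : ((n + 1).choose k : ℝ) * (n + 1 - k) = n.choose k * (n + 1) := by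
    rcases le_or_gt k (n + 1) with h | h
    · rw [← Nat.cast_add_one, ← Nat.cast_sub h]
      exact_mod_cast (Nat.choose_mul_succ_eq n k).symm
    · simp [Nat.choose_eq_zero_of_lt h, Nat.choose_eq_zero_of_lt ((Nat.lt_succ_self n).trans h)]
  have h₂ : ((n + 1 + k).choose (n + 1) : ℝ) * (n + 1) = (n + 1 + k) * (n + k).choose n := by
    have h := Nat.add_one_mul_choose_eq (n + k) n
    rw [show n + 1 + k = n + k + 1 by ring]
    have h' : ((n + k + 1 : ℕ) : ℝ) * (n + k).choose n = (n + k + 1).choose (n + 1) * (n + 1) := by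
      exact_mod_cast h
    push_cast at h'
    linear_combination -h'
  rw [show n + 1 + k = n + k + 1 by ring] at h₂ ⊢
  rw [pow_succ]
  linear_combination (-(-1) ^ (n + k) * ((n + k + 1).choose (n + 1) : ℝ)) * h₁
    - (-1) ^ (n + k) * (n.choose k : ℝ) * h₂

lemma coeff_succ_unitLegendre_add_two (n k : ℕ) :
    ((k : ℝ) + 1) ^ 2 * (unitLegendre (n + 2)).coeff (k + 1) =
      (n + k + 3) * (n + k + 2) * (unitLegendre (n + 1)).coeff k := by
  have h₁ := coeff_succ_unitLegendre (n + 2) k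
  have h₂ := coeff_unitLegendre_succ (n + 1) k
  push_cast at h₁ h₂
  linear_combination h₁ - (n + k + 3) * h₂

lemma coeff_succ_unitLegendre_pred (n k : ℕ) :
    ((k : ℝ) + 1) ^ 2 * (unitLegendre n).coeff (k + 1) =
      (n - k) * (n + 1 - k) * (unitLegendre (n + 1)).coeff k := by
  linear_combination coeff_succ_unitLegendre n k - (n - k) * coeff_unitLegendre_succ n k

section

open Polynomial

lemma unitLegendre_zero : unitLegendre 0 = 1 := by
  ext k
  rcases k with _ | k <;> simp [coeff_unitLegendre, Polynomial.coeff_one]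

lemma unitLegendre_one : unitLegendre 1 = C 2 * X - 1 := by
  ext k
  rcases k with _ | _ | k
  · simp [coeff_unitLegendre]
  · simp [coeff_unitLegendre, Polynomial.coeff_one]
  · simp [coeff_unitLegendre, Polynomial.coeff_one, Nat.choose_eq_zero_of_lt]

lemma derivative_unitLegendre_sub (n : ℕ) :
    derivative (unitLegendre (n + 2) - unitLegendre n) =
      C (2 * (2 * n + 3) : ℝ) * unitLegendre (n + 1) := by
  ext k
  rw [coeff_derivative, coeff_sub, coeff_C_mul]
  have hk : (k : ℝ) + 1 ≠ 0 := by positivity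
  apply mul_left_cancel₀ hk
  linear_combination coeff_succ_unitLegendre_add_two n k - coeff_succ_unitLegendre_pred n k

/-- Bonnet's three-term recurrence. -/
lemma unitLegendre_bonnet (n : ℕ) :
    C ((n : ℝ) + 2) * unitLegendre (n + 2) =
      C (2 * n + 3 : ℝ) * ((C 2 * X - 1) * unitLegendre (n + 1))
        - C ((n : ℝ) + 1) * unitLegendre n := by
  ext k
  simp only [coeff_C_mul, coeff_sub, sub_mul, one_mul, mul_assoc]
  rcases k with _ | k
  · simp only [coeff_zero_unitLegendre, coeff_X_mul_zero]
    ring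
  · rw [coeff_X_mul]
    have hk : ((k : ℝ) + 1) ^ 2 ≠ 0 := by positivity
    apply mul_left_cancel₀ hk
    have h := coeff_succ_unitLegendre (n + 1) k
    push_cast at h
    linear_combination (n + 2) * coeff_succ_unitLegendre_add_two n k
      + (n + 1) * coeff_succ_unitLegendre_pred n k + (2 * n + 3) * h

/-- Legendre's differential equation. -/
lemma derivative_mul_derivative_unitLegendre (n : ℕ) :
    derivative (X * (1 - X) * derivative (unitLegendre n)) =
      -(C ((n : ℝ) * (n + 1)) * unitLegendre n) := by
  ext k
  rw [coeff_derivative, coeff_neg, coeff_C_mul, mul_assoc, coeff_X_mul, sub_mul, one_mul,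
    coeff_sub, coeff_derivative]
  rcases k with _ | k
  · have h := coeff_succ_unitLegendre n 0
    simp only [coeff_X_mul_zero]
    push_cast at h ⊢
    linear_combination h
  · rw [coeff_X_mul, coeff_derivative]
    have h := coeff_succ_unitLegendre n (k + 1)
    push_cast at h ⊢
    linear_combination h

/-- Integration of real polynomials over `[0, 1]`. -/
noncomputable def unitIntegral : ℝ[X] →ₗ[ℝ] ℝ where
  toFun p := ∫ x in (0 : ℝ)..1, p.eval x
  map_add' p q := by
    simp only [eval_add]
    exact intervalIntegral.integral_add (p.continuous.intervalIntegrable _ _)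
      (q.continuous.intervalIntegrable _ _)
  map_smul' a p := by simp

lemma integral_eval_derivative (p : ℝ[X]) (a b : ℝ) :
    ∫ x in a..b, (derivative p).eval x = p.eval b - p.eval a :=
  intervalIntegral.integral_eq_sub_of_hasDerivAt (fun x _ => p.hasDerivAt x)
    ((derivative p).continuous.intervalIntegrable _ _)

lemma unitIntegral_C_mul (a : ℝ) (p : ℝ[X]) : unitIntegral (C a * p) = a * unitIntegral p := by
  rw [← smul_eq_C_mul, map_smul, smul_eq_mul]

lemma unitIntegral_mul_of_ne {m n : ℕ} (h : m ≠ n) :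
    unitIntegral (unitLegendre m * unitLegendre n) = 0 := by
  have hd : derivative (X * (1 - X) * derivative (unitLegendre m) * unitLegendre n
      - X * (1 - X) * derivative (unitLegendre n) * unitLegendre m) =
      C ((n : ℝ) * (n + 1) - m * (m + 1)) * (unitLegendre m * unitLegendre n) := by
    rw [derivative_sub, derivative_mul (g := unitLegendre n), derivative_mul (g := unitLegendre m),
      derivative_mul_derivative_unitLegendre, derivative_mul_derivative_unitLegendre, C_sub]
    ring
  have hi : ((n : ℝ) * (n + 1) - m * (m + 1)) *
      unitIntegral (unitLegendre m * unitLegendre n) = 0 := by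
    rw [← unitIntegral_C_mul, ← hd]
    exact (integral_eval_derivative _ 0 1).trans (by simp)
  refine (mul_eq_zero.mp hi).resolve_left fun h0 => h ?_
  have hpos : (n : ℝ) + m + 1 ≠ 0 := by positivity
  have : ((n : ℝ) - m) * (n + m + 1) = 0 := by linear_combination h0
  exact_mod_cast (sub_eq_zero.mp ((mul_eq_zero.mp this).resolve_right hpos)).symm

lemma unitIntegral_mul_self (n : ℕ) :
    (2 * n + 1) * unitIntegral (unitLegendre n * unitLegendre n) = 1 := by
  induction n with
  | zero => simp [unitLegendre_zero, unitIntegral]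
  | succ n ih =>
    suffices h : (2 * (n : ℝ) + 3) * unitIntegral (unitLegendre (n + 1) * unitLegendre (n + 1)) =
        (2 * n + 1) * unitIntegral (unitLegendre n * unitLegendre n) by
      push_cast
      linear_combination h + ih
    rcases n with _ | n
    · have h : unitLegendre 1 * unitLegendre 1 = derivative
          (C (4 / 3 : ℝ) * X ^ 3 - C 2 * X ^ 2 + X) := by
        rw [unitLegendre_one]
        simp only [derivative_add, derivative_sub, derivative_C_mul, derivative_X_pow,
          derivative_X]
        refine Polynomial.funext fun x => ?_
        simp
        ring
      have h' : unitIntegral (unitLegendre 1 * unitLegendre 1) = 1 / 3 := by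
        rw [h]
        refine (integral_eval_derivative _ 0 1).trans ?_
        norm_num
      rw [zero_add, h']
      linear_combination -ih
    · have h₁ := congrArg (fun p => unitIntegral (unitLegendre (n + 2) * p)) (unitLegendre_bonnet n)
      have h₂ := congrArg (fun p => unitIntegral (unitLegendre (n + 1) * p))
        (unitLegendre_bonnet (n + 1))
      simp only [mul_sub, mul_left_comm _ (C _), map_sub, unitIntegral_C_mul] at h₁ h₂
      rw [unitIntegral_mul_of_ne (by omega : n + 2 ≠ n)] at h₁
      rw [unitIntegral_mul_of_ne (by omega : n + 1 ≠ n + 1 + 2)] at h₂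
      rw [show unitLegendre (n + 1) * ((C 2 * X - 1) * unitLegendre (n + 1 + 1)) =
        unitLegendre (n + 2) * ((C 2 * X - 1) * unitLegendre (n + 1)) by ring] at h₂
      push_cast at h₂ ⊢
      have hn : (n : ℝ) + 2 ≠ 0 := by positivity
      apply mul_left_cancel₀ hn
      linear_combination (2 * (n : ℝ) + 5) * h₁ - (2 * n + 3) * h₂

lemma unitIntegral_mul (m n : ℕ) :
    unitIntegral (unitLegendre m * unitLegendre n) = if m = n then 1 / (2 * (m : ℝ) + 1) else 0 := by
  split_ifs with h
  · subst h
    rw [eq_div_iff (by positivity), mul_comm]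
    exact unitIntegral_mul_self m
  · exact unitIntegral_mul_of_ne h

/-- The antiderivative of `unitLegendre n` vanishing at `0`. -/
noncomputable def unitLegendrePrimitive : ℕ → ℝ[X]
  | 0 => C (1 / 2) * (unitLegendre 1 + unitLegendre 0)
  | n + 1 => C (1 / (2 * (2 * n + 3)) : ℝ) * (unitLegendre (n + 2) - unitLegendre n)

lemma derivative_unitLegendrePrimitive (n : ℕ) :
    derivative (unitLegendrePrimitive n) = unitLegendre n := by
  rcases n with _ | n
  · rw [unitLegendrePrimitive, unitLegendre_one, unitLegendre_zero]
    simp [← mul_assoc, ← C_mul]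
  · have hn : (2 * (2 * n + 3) : ℝ) ≠ 0 := by positivity
    rw [unitLegendrePrimitive, derivative_C_mul, derivative_unitLegendre_sub, ← mul_assoc, ← C_mul,
      one_div_mul_cancel hn, C_1, one_mul]

lemma eval_zero_unitLegendrePrimitive (n : ℕ) : (unitLegendrePrimitive n).eval 0 = 0 := by
  rcases n with _ | n <;>
    simp [unitLegendrePrimitive, ← coeff_zero_eq_eval_zero, coeff_zero_unitLegendre, pow_add]

end

lemma integral_legP {T : ℝ} (hT : T ≠ 0) (n : ℕ) (t : ℝ) :
    ∫ τ in (0 : ℝ)..t, legP T n τ =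
      √((2 * n + 1) / T) * (T * (unitLegendrePrimitive n).eval (t / T)) := by
  simp only [legP_eq_eval, intervalIntegral.integral_const_mul]
  rw [intervalIntegral.integral_comp_div (fun x => (unitLegendre n).eval x) hT,
    ← derivative_unitLegendrePrimitive, integral_eval_derivative]
  simp [eval_zero_unitLegendrePrimitive]

lemma integral_legP_mul_integral_legP {T : ℝ} (hT : 0 < T) (i j : ℕ) :
    (∫ t in (0 : ℝ)..T, legP T i t * ∫ τ in (0 : ℝ)..t, legP T j τ) =
      T * (√(2 * i + 1) * √(2 * j + 1)) *
        unitIntegral (unitLegendre i * unitLegendrePrimitive j) := by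
  have h : ∀ t, legP T i t * ∫ τ in (0 : ℝ)..t, legP T j τ =
      √((2 * i + 1) / T) * √((2 * j + 1) / T) * T *
        (unitLegendre i * unitLegendrePrimitive j).eval (t / T) := fun t => by
    rw [integral_legP hT.ne', legP_eq_eval, Polynomial.eval_mul]
    ring
  simp only [h, intervalIntegral.integral_const_mul]
  rw [intervalIntegral.integral_comp_div
    (fun x => (unitLegendre i * unitLegendrePrimitive j).eval x) hT.ne', zero_div, div_self hT.ne',
    Real.sqrt_div (by positivity), Real.sqrt_div (by positivity), smul_eq_mul]
  change _ * (T * unitIntegral _) = _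
  have hs := Real.mul_self_sqrt hT.le
  have hs0 : √T ≠ 0 := (Real.sqrt_pos.mpr hT).ne'
  field_simp
  rw [sq √T, hs]

/-- The normalising factors of consecutive Legendre polynomials combine into an off-diagonal
entry of the integration matrix. -/
lemma sqrt_mul_sqrt_div (n : ℕ) :
    √(2 * (n : ℝ) + 1) * √(2 * n + 3) / ((2 * n + 1) * (2 * n + 3)) =
      1 / √(4 * ((n : ℝ) + 1) ^ 2 - 1) := by
  rw [show 4 * ((n : ℝ) + 1) ^ 2 - 1 = (2 * n + 1) * (2 * n + 3) by ring,
    ← Real.sqrt_mul (by positivity), Real.sqrt_div_self']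

open scoped Classical in
/-- the matrix representation of the first-order integration operator relative
to the Legendre polynomials is tridiagonal. -/
theorem legP_integration_matrix (T : ℝ) (hT : 0 < T) (i j : ℕ) :
    (∫ t in (0:ℝ)..T, legP T i t * ∫ τ in (0:ℝ)..t, legP T j τ) =
      if i = 0 ∧ j = 0 then T / 2
      else if i = j + 1 then T / (2 * Real.sqrt (4 * (i : ℝ) ^ 2 - 1))
      else if j = i + 1 then -(T / (2 * Real.sqrt (4 * (j : ℝ) ^ 2 - 1)))
      else 0 := by
  rw [integral_legP_mul_integral_legP hT]
  rcases j with _ | j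
  · rw [unitLegendrePrimitive, mul_left_comm (unitLegendre i), unitIntegral_C_mul, mul_add, map_add,
      unitIntegral_mul, unitIntegral_mul]
    rcases i with _ | _ | i
    · simp
      ring
    · have h := sqrt_mul_sqrt_div 0
      norm_num at h ⊢
      linear_combination (T / 2) * h
    · simp
  · rw [unitLegendrePrimitive, mul_left_comm (unitLegendre i), unitIntegral_C_mul, mul_sub, map_sub,
      unitIntegral_mul, unitIntegral_mul]
    rw [if_neg (by omega : ¬(i = 0 ∧ j + 1 = 0))]
    by_cases h₁ : i = j + 2
    · subst h₁
      have h := sqrt_mul_sqrt_div (j + 1)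
      rw [if_pos rfl, if_neg (by omega), if_pos rfl, ← div_div T, div_eq_mul_one_div (T / 2)]
      push_cast at h ⊢
      rw [show (j : ℝ) + 2 = j + 1 + 1 by ring, ← h,
        show 2 * ((j : ℝ) + 1 + 1) + 1 = 2 * (j + 1) + 3 by ring]
      field_simp
      ring
    · rw [if_neg h₁, if_neg (by omega : ¬ i = j + 1 + 1)]
      by_cases h₂ : i = j
      · subst h₂
        have h := sqrt_mul_sqrt_div i
        rw [if_pos rfl, if_pos rfl, ← div_div T, div_eq_mul_one_div (T / 2)]
        push_cast at h ⊢
        rw [← h, show 2 * ((i : ℝ) + 1) + 1 = 2 * i + 3 by ring]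
        field_simp
        ring
      · rw [if_neg h₂, if_neg (by omega : ¬ j + 1 = i + 1)]
        simp
end

section
/- For every T > 0, every real β > 0, and all i, j ∈ ℕ, the matrix representation of the Riemann–Liouville fractional integration operator of order β relative to the Legendre polynomials satisfies the parity symmetry P_{ij}^{-β} = (-1)^{i+j} · P_{ji}^{-β}; that is, elements with even index sum form a symmetric part and elements with odd index sum form a skew-symmetric part. -/
open MeasureTheory Finset

/-- `P_{ij}^{-β} = ∫₀^T P̂(i,t) (J^β P̂(j,·))(t) dt`. -/
noncomputable def Pcoef (T β : ℝ) (i j : ℕ) : ℝ :=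
  ∫ t in (0:ℝ)..T, legP T i t * rlInt β (legP T j) t

/-- The values of the shifted Legendre polynomials at `t` and `T - t` differ by `(-1) ^ i`. -/
theorem legP_sub_left {T : ℝ} (hT : T ≠ 0) (i : ℕ) (t : ℝ) :
    legP T i (T - t) = (-1 : ℝ) ^ i * legP T i t := by
  have key (x : ℝ) : ∑ k ∈ range (i + 1), legCoef i k * x ^ k =
      (-1 : ℝ) ^ i * Polynomial.aeval x (Polynomial.shiftedLegendre i) := by
    rw [Polynomial.shiftedLegendre, map_sum, mul_sum]
    refine sum_congr rfl fun k hk => ?_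
    have hk : k ≤ i := Nat.lt_succ_iff.mp (mem_range.mp hk)
    have hsign : (-1 : ℝ) ^ (i - k) = (-1) ^ i * (-1) ^ k := by
      obtain ⟨m, rfl⟩ := Nat.exists_eq_add_of_le hk
      rw [Nat.add_sub_cancel_left, pow_add, mul_right_comm, ← mul_pow]
      simp
    rw [legCoef, hsign, Nat.choose_symm hk, map_mul, Polynomial.aeval_C, map_pow,
      Polynomial.aeval_X, algebraMap_int_eq, eq_intCast]
    push_cast
    ring
  simp only [legP, key]
  rw [Polynomial.shiftedLegendre_eval_symm i (t / T), sub_div, div_self hT]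
  have h : (-1 : ℝ) ^ i * (-1) ^ i = 1 := by rw [← mul_pow]; simp
  linear_combination (-√((2 * i + 1) / T) * (-1 : ℝ) ^ i *
    Polynomial.aeval (1 - t / T) (Polynomial.shiftedLegendre i)) * h

theorem integral_mul_rlInt {T : ℝ} (hT : 0 ≤ T) (β : ℝ) (φ ψ : ℝ → ℝ) :
    ∫ t in (0 : ℝ)..T, φ t * rlInt β ψ t = 1 / Real.Gamma β * ∫ t, ∫ τ,
      (Set.Icc 0 T).indicator φ t * ((Set.Icc 0 T).indicator ψ τ *
        (Set.Icc 0 T).indicator (fun u => u ^ (β - 1)) (t - τ)) := by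
  rw [intervalIntegral.integral_of_le hT, ← integral_Icc_eq_integral_Ioc,
    ← integral_indicator measurableSet_Icc, ← integral_const_mul]
  congr with t
  rw [integral_const_mul]
  by_cases ht : t ∈ Set.Icc 0 T
  · have h : (fun τ => (Set.Icc 0 T).indicator ψ τ *
        (Set.Icc 0 T).indicator (fun u => u ^ (β - 1)) (t - τ)) =
        (Set.Icc 0 t).indicator fun τ => ψ τ * (t - τ) ^ (β - 1) := by
      ext τ
      obtain ⟨h0, h1⟩ := ht
      by_cases hτ : τ ∈ Set.Icc 0 t
      · have h2 : τ ∈ Set.Icc 0 T := ⟨hτ.1, hτ.2.trans h1⟩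
        have h3 : t - τ ∈ Set.Icc 0 T := ⟨by linarith [hτ.2], by linarith [hτ.1]⟩
        simp only [Set.indicator_of_mem, hτ, h2, h3]
      · rw [Set.indicator_of_notMem hτ]
        by_cases h2 : τ ∈ Set.Icc 0 T
        · have h3 : t - τ ∉ Set.Icc 0 T := fun h => hτ ⟨h2.1, by linarith [h.1]⟩
          rw [Set.indicator_of_notMem h3, mul_zero]
        · rw [Set.indicator_of_notMem h2, zero_mul]
    rw [h, Set.indicator_of_mem ht, Set.indicator_of_mem ht, rlInt,
      integral_indicator measurableSet_Icc, integral_Icc_eq_integral_Ioc,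
      ← intervalIntegral.integral_of_le ht.1]
    ring
  · simp [Set.indicator_of_notMem ht]

theorem integrable_mul_rpow_kernel {T β : ℝ} (hβ : 0 < β) {φ ψ : ℝ → ℝ}
    (hφ : Continuous φ) (hψ : Continuous ψ) :
    Integrable (fun p : ℝ × ℝ => (Set.Icc 0 T).indicator φ p.1 * ((Set.Icc 0 T).indicator ψ p.2 *
      (Set.Icc 0 T).indicator (fun u => u ^ (β - 1)) (p.1 - p.2))) := by
  have hK : Integrable ((Set.Icc 0 T).indicator fun u : ℝ => u ^ (β - 1)) := by
    rw [integrable_indicator_iff measurableSet_Icc, integrableOn_Icc_iff_integrableOn_Ioc]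
    exact (intervalIntegral.intervalIntegrable_rpow' (a := 0) (b := T) (by linarith)).1
  have hψ' : Integrable ((Set.Icc 0 T).indicator ψ) :=
    (hψ.continuousOn.integrableOn_compact isCompact_Icc).integrable_indicator measurableSet_Icc
  obtain ⟨C, hC⟩ := isCompact_Icc.exists_bound_of_continuousOn (s := Set.Icc 0 T) hφ.continuousOn
  refine (hψ'.convolution_integrand (ContinuousLinearMap.mul ℝ ℝ) hK).bdd_mul (c := max C 0)
    ((hφ.measurable.indicator measurableSet_Icc).comp measurable_fst).aestronglyMeasurable
    (.of_forall fun p => ?_)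
  by_cases hp : p.1 ∈ Set.Icc 0 T
  · rw [Set.indicator_of_mem hp]
    exact (hC _ hp).trans (le_max_left _ _)
  · simp [Set.indicator_of_notMem hp]

/-- The adjoint of fractional integration on `[0, T]` is its conjugate by `t ↦ T - t`. -/
theorem integral_mul_rlInt_eq_reflect {T β : ℝ} (hT : 0 ≤ T) (hβ : 0 < β) {φ ψ : ℝ → ℝ}
    (hφ : Continuous φ) (hψ : Continuous ψ) :
    ∫ t in (0 : ℝ)..T, φ t * rlInt β ψ t =
      ∫ t in (0 : ℝ)..T, ψ (T - t) * rlInt β (fun s => φ (T - s)) t := by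
  have reflect (f : ℝ → ℝ) (t : ℝ) : (Set.Icc 0 T).indicator f (T - t) =
      (Set.Icc 0 T).indicator (fun s => f (T - s)) t := by
    have h : T - t ∈ Set.Icc 0 T ↔ t ∈ Set.Icc 0 T := by
      simp only [Set.mem_Icc]
      constructor <;> rintro ⟨_, _⟩ <;> constructor <;> linarith
    by_cases ht : t ∈ Set.Icc 0 T
    · rw [Set.indicator_of_mem ht, Set.indicator_of_mem (h.mpr ht)]
    · rw [Set.indicator_of_notMem ht, Set.indicator_of_notMem (mt h.mp ht)]
  rw [integral_mul_rlInt hT, integral_mul_rlInt hT,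
    integral_integral_swap (integrable_mul_rpow_kernel hβ hφ hψ),
    ← integral_sub_left_eq_self _ volume T]
  congr with τ
  rw [← integral_sub_left_eq_self _ volume T]
  congr with t
  rw [reflect φ, reflect ψ, sub_sub_sub_cancel_left]
  ring

/-- parity symmetry of the matrix representation of the fractional
integration operator: `P_{ij}^{-β} = (-1)^{i+j} P_{ji}^{-β}`. -/
theorem Pcoef_parity (T : ℝ) (hT : 0 < T) (β : ℝ) (hβ : 0 < β) (i j : ℕ) :
    Pcoef T β i j = (-1 : ℝ) ^ (i + j) * Pcoef T β j i := by
  rw [Pcoef, integral_mul_rlInt_eq_reflect hT.le hβ (continuous_legP T i) (continuous_legP T j), Pcoef,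
    ← intervalIntegral.integral_const_mul]
  congr with t
  simp only [legP_sub_left hT.ne', rlInt, mul_assoc, intervalIntegral.integral_const_mul, pow_add]
  ring
end

section
/- For every H ∈ (0,1) and all i, j ∈ ℕ, the expansion coefficients K_{ij}^H reflect the self-similarity of the fractional Brownian motion: denoting by K_{ij}^H(T) the coefficient defined on the interval [0,T], one has K_{ij}^H(T) = T^{H+1/2} · K_{ij}^H(1) for every T > 0; in particular K_{ij}^H(T) / T^{H+1/2} does not depend on T. -/
open MeasureTheory Finset

theorem legP_mul_self {T : ℝ} (hT : 0 < T) (i : ℕ) (u : ℝ) :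
    legP T i (T * u) = (Real.sqrt T)⁻¹ * legP 1 i u := by
  unfold legP
  rw [mul_div_cancel_left₀ u hT.ne', div_one, div_one, Real.sqrt_div' _ hT.le]
  ring

theorem integral_zero_mul_of_comp_mul_eq {T u c : ℝ} (hu : 0 ≤ u) {f g : ℝ → ℝ}
    (h : ∀ v, 0 ≤ v → v ≤ u → f (T * v) = c * g v) :
    ∫ t in (0:ℝ)..(T * u), f t = T * c * ∫ v in (0:ℝ)..u, g v := by
  have hs := intervalIntegral.mul_integral_comp_mul_left (a := 0) (b := u) (f := f) T
  rw [mul_zero] at hs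
  rw [← hs, mul_assoc, ← intervalIntegral.integral_const_mul c]
  congr 1
  refine intervalIntegral.integral_congr fun v hv => ?_
  rw [Set.uIcc_of_le hu] at hv
  exact h v hv.1 hv.2

theorem rlInt_mul_of_comp_mul_eq {T u c : ℝ} (β : ℝ) (hT : 0 < T) (hu : 0 ≤ u) {φ ψ : ℝ → ℝ}
    (h : ∀ v, 0 ≤ v → φ (T * v) = c * ψ v) :
    rlInt β φ (T * u) = T ^ β * c * rlInt β ψ u := by
  unfold rlInt
  have key := integral_zero_mul_of_comp_mul_eq (T := T) (c := c * T ^ (β - 1)) hu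
    (f := fun τ => φ τ * (T * u - τ) ^ (β - 1)) (g := fun τ => ψ τ * (u - τ) ^ (β - 1))
    fun v hv hvu => by
      rw [h v hv, ← mul_sub, Real.mul_rpow hT.le (sub_nonneg.2 hvu)]
      ring
  rw [key, Real.rpow_sub_one hT.ne']
  field_simp

theorem rlInt_weighted_mul_of_comp_mul_eq {T u c : ℝ} (α β γ : ℝ) (hT : 0 < T) (hu : 0 ≤ u)
    {φ ψ : ℝ → ℝ} (h : ∀ v, 0 ≤ v → φ (T * v) = c * ψ v) :
    rlInt γ (fun s => s ^ α * rlInt β (fun τ => τ ^ (-α) * φ τ) s) (T * u) =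
      T ^ (γ + β) * c * rlInt γ (fun s => s ^ α * rlInt β (fun τ => τ ^ (-α) * ψ τ) s) u := by
  have hα : T ^ α * T ^ (-α) = 1 := by rw [← Real.rpow_add hT, add_neg_cancel, Real.rpow_zero]
  rw [Real.rpow_add hT, mul_assoc (T ^ γ)]
  refine rlInt_mul_of_comp_mul_eq γ hT hu fun s hs => ?_
  rw [rlInt_mul_of_comp_mul_eq (c := T ^ (-α) * c) (ψ := fun τ => τ ^ (-α) * ψ τ) β hT hs
    fun v hv => by rw [h v hv, Real.mul_rpow hT.le hv]; ring,
    Real.mul_rpow hT.le hs]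
  linear_combination (T ^ β * c * s ^ α * rlInt β (fun τ => τ ^ (-α) * ψ τ) s) * hα

theorem Kop_mul_of_comp_mul_eq {T u c : ℝ} (H : ℝ) (hT : 0 < T) (hu : 0 ≤ u) {φ ψ : ℝ → ℝ}
    (h : ∀ v, 0 ≤ v → φ (T * v) = c * ψ v) :
    Kop H φ (T * u) = T ^ (H + 1/2) * c * Kop H ψ u := by
  unfold Kop
  split_ifs with h₁ h₂
  · have key := rlInt_weighted_mul_of_comp_mul_eq (1/2 - H) (1/2 - H) (2 * H) hT hu h
    rw [show -(1/2 - H) = H - 1/2 by ring, show 2 * H + (1/2 - H) = H + 1/2 by ring] at key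
    rw [key]
    ring
  · have key := rlInt_weighted_mul_of_comp_mul_eq (H - 1/2) (H - 1/2) 1 hT hu h
    rw [show -(H - 1/2) = 1/2 - H by ring, show 1 + (H - 1/2) = H + 1/2 by ring] at key
    rw [key]
    ring
  · obtain rfl : H = 1/2 := le_antisymm (not_lt.1 h₂) (not_lt.1 h₁)
    rw [integral_zero_mul_of_comp_mul_eq hu fun v hv _ => h v hv, add_halves, Real.rpow_one]

/-- self-similarity: `K_{ij}^H(T) = T^{H+1/2} · K_{ij}^H(1)` for all `T > 0`;
in particular `K_{ij}^H(T) / T^{H+1/2}` does not depend on `T`. -/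
theorem Kcoef_self_similar (H : ℝ) (hH : H ∈ Set.Ioo (0:ℝ) 1) (i j : ℕ)
    (T : ℝ) (hT : 0 < T) :
    Kcoef T H i j = T ^ (H + 1/2) * Kcoef 1 H i j := by
  have key := integral_zero_mul_of_comp_mul_eq (T := T) (u := 1)
    (c := (Real.sqrt T)⁻¹ * (T ^ (H + 1/2) * (Real.sqrt T)⁻¹)) zero_le_one
    (f := fun t => legP T i t * Kop H (legP T j) t) (g := fun t => legP 1 i t * Kop H (legP 1 j) t)
    fun v hv _ => by
      rw [legP_mul_self hT, Kop_mul_of_comp_mul_eq H hT hv fun w _ => legP_mul_self hT j w]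
      ring
  rw [mul_one] at key
  have hsq : T * ((Real.sqrt T)⁻¹ * (Real.sqrt T)⁻¹) = 1 := by
    rw [← mul_inv, Real.mul_self_sqrt hT.le, mul_inv_cancel₀ hT.ne']
  unfold Kcoef
  rw [key]
  congr 1
  linear_combination T ^ (H + 1/2) * hsq
end
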